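/- For every k ≥ 1, the following identity of formal power series in z with coefficients in ℤ[x_1,…,x_k,t] holds: D(x,t,z) · Σ_{n≥1} W_n^≠(x,t) z^n = Σ_{i≥2} ([i]_t + i·t[i−2]_t) e_i(x) z^i, where W_n^≠(x,t) := Σ_w t^{des(w)} x_w, the sum over all Smirnov words w of length n over [k] with w_1 ≠ w_n. Consequently, each W_n^≠(x,t) is symmetric in x_1,…,x_k and e-positive. -/

import Mathlib

open Finset MvPolynomial Polynomial

attribute [local instance] Classical.propDecidable

noncomputable section

/-- The descent number of a word `w = w₁⋯wₙ` over the alphabet `[k]`: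
the number of indices `i ∈ [n-1]` with `wᵢ > wᵢ₊₁`. -/
def desc {n k : ℕ} (w : Fin n → Fin k) : ℕ :=
  (Finset.univ.filter fun i : Fin n =>
    ∃ h : (i : ℕ) + 1 < n, w ⟨(i : ℕ) + 1, h⟩ < w i).card

/-- The cyclic descent number: the number of indices `i ∈ [n]` with `wᵢ > wᵢ₊₁`,
where `wₙ₊₁ := w₁`. -/
def cdesc {n k : ℕ} (w : Fin n → Fin k) : ℕ :=
  (Finset.univ.filter fun i : Fin n =>
    w ⟨((i : ℕ) + 1) % n, Nat.mod_lt _ i.pos⟩ < w i).card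

/-- A word is Smirnov if no two adjacent letters are equal. -/
def IsSmirnov {n k : ℕ} (w : Fin n → Fin k) : Prop :=
  ∀ i : Fin n, ∀ h : (i : ℕ) + 1 < n, w ⟨(i : ℕ) + 1, h⟩ ≠ w i

/-- the first letter is strictly smaller than the last letter -/
def FirstLtLast {n k : ℕ} (w : Fin n → Fin k) : Prop :=
  ∃ h : 0 < n, w ⟨0, h⟩ < w ⟨n - 1, Nat.sub_lt h Nat.one_pos⟩

/-- the first letter is strictly larger than the last letter -/
def FirstGtLast {n k : ℕ} (w : Fin n → Fin k) : Prop :=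
  ∃ h : 0 < n, w ⟨n - 1, Nat.sub_lt h Nat.one_pos⟩ < w ⟨0, h⟩

/-- the first letter equals the last letter -/
def FirstEqLast {n k : ℕ} (w : Fin n → Fin k) : Prop :=
  ∃ h : 0 < n, w ⟨0, h⟩ = w ⟨n - 1, Nat.sub_lt h Nat.one_pos⟩

/-- the first letter differs from the last letter -/
def FirstNeLast {n k : ℕ} (w : Fin n → Fin k) : Prop :=
  ∃ h : 0 < n, w ⟨0, h⟩ ≠ w ⟨n - 1, Nat.sub_lt h Nat.one_pos⟩

/-- the monomial `x_w = x_{w₁}⋯x_{wₙ}` -/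
def xw (R : Type) [CommRing R] {n k : ℕ} (w : Fin n → Fin k) : MvPolynomial (Fin k) R :=
  ∏ i, MvPolynomial.X (w i)

/-- Generic restricted Smirnov word enumerator: the sum of `t^(stat w) · x_w` over all
Smirnov words `w` of length `n` over `[k]` satisfying `P`, as a polynomial in `t`
with coefficients in `R[x₁,…,x_k]`. -/
def smirnovEnum (R : Type) [CommRing R] (n k : ℕ) (stat : (Fin n → Fin k) → ℕ)
    (P : (Fin n → Fin k) → Prop) : Polynomial (MvPolynomial (Fin k) R) :=
  ∑ w ∈ Finset.univ.filter (fun w : Fin n → Fin k => IsSmirnov w ∧ P w),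
    Polynomial.X ^ stat w * Polynomial.C (xw R w)

/-- the t-analogue `[m]_t = 1 + t + ⋯ + t^(m-1)`, as a polynomial in `t = Polynomial.X`
with coefficients in `R[x₁,…,x_k]` -/
def tnum (R : Type) [CommRing R] (k m : ℕ) : Polynomial (MvPolynomial (Fin k) R) :=
  ∑ j ∈ Finset.range m, Polynomial.X ^ j

/-- `D(x,t,z) = 1 - Σ_{i≥2} t[i-1]_t e_i(x) z^i`, a formal power series in `z` whose
coefficients are polynomials in `t` with coefficients in `R[x₁,…,x_k]`. -/
def Dser (R : Type) [CommRing R] (k : ℕ) : PowerSeries (Polynomial (MvPolynomial (Fin k) R)) :=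
  PowerSeries.mk fun i =>
    if i = 0 then 1
    else if i = 1 then 0
    else -(Polynomial.X * tnum R k (i - 1) * Polynomial.C (esymm (Fin k) R i))

/-- e-positivity of a symmetric polynomial in `x₁,…,x_k` (no `t`): it is a nonnegative
combination of products `e_λ = e_{λ₁}⋯e_{λ_ℓ}` over partitions `λ` (multisets of positive
integers). -/
def EPosX (R : Type) [CommRing R] [PartialOrder R] {k : ℕ} (P : MvPolynomial (Fin k) R) : Prop :=
  ∃ (S : Finset (Multiset ℕ)) (c : Multiset ℕ → R),
    (∀ μ ∈ S, ∀ i ∈ μ, 0 < i) ∧ (∀ μ ∈ S, 0 ≤ c μ) ∧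
    P = ∑ μ ∈ S, MvPolynomial.C (c μ) * (μ.map (esymm (Fin k) R)).prod

/-- e-positivity of a polynomial in `t` with coefficients in `R[x₁,…,x_k]`:
`P = Σ_λ c_λ(t) e_λ(x)` over partitions `λ`, where each `c_λ(t)` has nonnegative
coefficients. -/
def EPosT (R : Type) [CommRing R] [PartialOrder R] {k : ℕ}
    (P : Polynomial (MvPolynomial (Fin k) R)) : Prop :=
  ∃ (S : Finset (Multiset ℕ)) (c : Multiset ℕ → Polynomial R),
    (∀ μ ∈ S, ∀ i ∈ μ, 0 < i) ∧ (∀ μ ∈ S, ∀ j, 0 ≤ (c μ).coeff j) ∧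
    P = ∑ μ ∈ S, ((c μ).map (MvPolynomial.C : R →+* MvPolynomial (Fin k) R)) *
          Polynomial.C ((μ.map (esymm (Fin k) R)).prod)

/-- `P`, a polynomial in `t` with coefficients in `R[x₁,…,x_k]`, is symmetric in
`x₁,…,x_k`. -/
def SymmX (R : Type) [CommRing R] {k : ℕ} (P : Polynomial (MvPolynomial (Fin k) R)) : Prop :=
  ∀ j : ℕ, (P.coeff j).IsSymmetric

theorem absT {A : Type*} [CommRing A] (k : ℕ) (f y : ℕ → A) (t T : A)
    (hT : T = ∑ c ∈ range k, f c)
    (h : ∀ a < k, f a * (1 + y a) = y a * (1 + T - (1 - t) * ∑ c ∈ range a, f c)) :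
    T * (∏ c ∈ range k, (1 + t * y c) - t * ∏ c ∈ range k, (1 + y c)) =
      ∏ c ∈ range k, (1 + y c) - ∏ c ∈ range k, (1 + t * y c) := by
  have key : ∀ m ≤ k, (1 + T - (1 - t) * ∑ c ∈ range m, f c) * ∏ c ∈ range m, (1 + y c) =
      (1 + T) * ∏ c ∈ range m, (1 + t * y c) := by
    intro m
    induction m with
    | zero => simp
    | succ m ih =>
      intro hm
      have h1 := ih (by omega)
      have h2 := h m (by omega)
      rw [prod_range_succ, prod_range_succ, sum_range_succ]
      linear_combination (1 + t * y m) * h1 - (1 - t) * (∏ c ∈ range m, (1 + y c)) * h2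
  have := key k le_rfl
  rw [← hT] at this
  linear_combination -this

theorem absB {A : Type*} [CommRing A] [IsDomain A] (k b : ℕ) (hb : b < k) (f y : ℕ → A) (t T : A)
    (hT : T = ∑ c ∈ range k, f c)
    (hy : ∀ a, 1 + y a ≠ 0)
    (h : ∀ a < k, f a * (1 + y a) =
      y a * ((if a = b then 1 else 0) + T - (1 - t) * ∑ c ∈ range a, f c)) :
    f b * (∏ c ∈ range k, (1 + t * y c) - t * ∏ c ∈ range k, (1 + y c)) =
      y b * (∏ c ∈ (range k).erase b, (1 + t * y c) -
        t * ∏ c ∈ (range k).erase b, (1 + y c)) := by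
  have key1 : ∀ m ≤ b, (T - (1 - t) * ∑ c ∈ range m, f c) * ∏ c ∈ range m, (1 + y c) =
      T * ∏ c ∈ range m, (1 + t * y c) := by
    intro m
    induction m with
    | zero => simp
    | succ m ih =>
      intro hm
      have h1 := ih (by omega)
      have h2 := h m (by omega)
      rw [if_neg (by omega)] at h2
      rw [prod_range_succ, prod_range_succ, sum_range_succ]
      linear_combination (1 + t * y m) * h1 - (1 - t) * (∏ c ∈ range m, (1 + y c)) * h2
  have key2 : ∀ m, b + 1 ≤ m → m ≤ k →
      (T - (1 - t) * ∑ c ∈ range m, f c) * ∏ c ∈ Ico (b+1) m, (1 + y c) =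
      (T - (1 - t) * ∑ c ∈ range (b+1), f c) * ∏ c ∈ Ico (b+1) m, (1 + t * y c) := by
    intro m hm
    induction m, hm using Nat.le_induction with
    | base => simp
    | succ m hm ih =>
      intro hmk
      have h1 := ih (by omega)
      have h2 := h m (by omega)
      rw [if_neg (by omega)] at h2
      rw [prod_Ico_succ_top hm, prod_Ico_succ_top hm, sum_range_succ]
      linear_combination (1 + t * y m) * h1 - (1 - t) * (∏ c ∈ Ico (b+1) m, (1 + y c)) * h2
  have k1 := key1 b le_rfl
  have k2 := key2 k hb le_rfl
  have k3 := h b hb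
  rw [if_pos rfl] at k3
  have tot : ∀ g : ℕ → A, ∏ c ∈ range k, g c =
      (∏ c ∈ range b, g c) * g b * ∏ c ∈ Ico (b+1) k, g c := by
    intro g
    rw [← prod_range_mul_prod_Ico g (show b + 1 ≤ k from hb), prod_range_succ]
  have ers : ∀ g : ℕ → A, ∏ c ∈ (range k).erase b, g c =
      (∏ c ∈ range b, g c) * ∏ c ∈ Ico (b+1) k, g c := by
    intro g
    have hd : Disjoint (range b) (Ico (b+1) k) := by
      rw [Finset.disjoint_left]; intro x hx hx'
      simp at hx hx'; omega
    rw [← prod_union hd]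
    apply prod_congr _ (fun _ _ => rfl)
    ext x; simp; omega
  rw [tot, tot, ers, ers]
  have hQ : ∏ c ∈ range b, (1 + y c) ≠ 0 := prod_ne_zero_iff.mpr fun a _ => hy a
  rw [← hT, sum_range_succ] at k2
  set S := ∑ c ∈ range b, f c
  set Q1 := ∏ c ∈ range b, (1 + y c)
  set P1 := ∏ c ∈ range b, (1 + t * y c)
  set Q2 := ∏ c ∈ Ico (b+1) k, (1 + y c)
  set P2 := ∏ c ∈ Ico (b+1) k, (1 + t * y c)
  have k4 : (T - (1 - t) * S) * (P1 * (1 + t * y b) * P2 - t * (Q1 * (1 + y b) * Q2)) =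
      (1 - t) * y b * (P1 * P2) := by
    apply mul_left_cancel₀ hQ
    linear_combination (-t * (1 + y b) * Q1 * Q2) * k1 - Q1 * P1 * (1 + y b) * k2
      + Q1 * P1 * P2 * (1 - t) * k3
  apply mul_left_cancel₀ (hy b)
  linear_combination (P1 * (1 + t * y b) * P2 - t * (Q1 * (1 + y b) * Q2)) * k3 + y b * k4

def exN {A : Type*} [Zero A] {k : ℕ} (g : Fin k → A) : ℕ → A :=
  fun a => if h : a < k then g ⟨a, h⟩ else 0

theorem exN_val {A : Type*} [Zero A] {k : ℕ} (g : Fin k → A) (a : Fin k) : exN g a = g a := by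
  simp [exN]

theorem sum_step {A : Type*} [CommRing A] {k : ℕ} (f : Fin k → A) (t : A) (a : Fin k) :
    ∑ c, (if a < c then 1 else if c < a then t else 0) * f c =
      ∑ c ∈ range k, exN f c - f a - (1 - t) * ∑ c ∈ range (a : ℕ), exN f c := by
  have h1 : ∑ c ∈ range (a : ℕ), exN f c = ∑ c : Fin k, if c < a then f c else 0 := by
    have : ∑ c : Fin k, (if c < a then f c else 0) =
        ∑ c : Fin k, (fun m : ℕ => if m < (a : ℕ) then exN f m else 0) (c : ℕ) := by
      apply Finset.sum_congr rfl
      intro c _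
      simp only [exN_val, Fin.lt_def]
    rw [this, Fin.sum_univ_eq_sum_range (fun m : ℕ => if m < (a : ℕ) then exN f m else 0) k,
      ← Finset.sum_filter]
    apply Finset.sum_congr _ (fun _ _ => rfl)
    ext x
    have := a.isLt
    simp; omega
  have h2 : f a = ∑ c : Fin k, if c = a then f c else 0 := by simp
  rw [h1, ← Fin.sum_univ_eq_sum_range (exN f) k, h2, Finset.mul_sum, ← Finset.sum_sub_distrib,
    ← Finset.sum_sub_distrib]
  apply Finset.sum_congr rfl
  intro c _
  rw [exN_val]
  rcases lt_trichotomy a c with h | h | h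
  · simp [h, h.ne', h.not_gt]
  · simp [h]
  · simp [h, h.ne, h.not_gt]
    ring

theorem prod_ex {A : Type*} [CommRing A] {k : ℕ} (y : Fin k → A) (t : A) :
    ∏ c ∈ range k, (1 + t * exN y c) = ∏ c : Fin k, (1 + t * y c) := by
  rw [← Fin.prod_univ_eq_prod_range (fun c => 1 + t * exN y c) k]
  simp [exN_val]

theorem prod_ex_erase {A : Type*} [CommRing A] {k : ℕ} (y : Fin k → A) (t : A) (b : Fin k) :
    ∏ c ∈ (range k).erase b, (1 + t * exN y c) = ∏ c ∈ univ.erase b, (1 + t * y c) := by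
  have : (range k).erase (b : ℕ) = ((univ : Finset (Fin k)).erase b).map Fin.valEmbedding := by
    ext x
    simp only [mem_erase, mem_range, mem_map, mem_univ, and_true, Fin.valEmbedding_apply]
    constructor
    · rintro ⟨h1, h2⟩
      exact ⟨⟨x, h2⟩, fun h => h1 (by rw [← h]), rfl⟩
    · rintro ⟨c, hc, rfl⟩
      exact ⟨fun h => hc (Fin.ext h), c.isLt⟩
  rw [this, Finset.prod_map]
  simp [exN_val]

theorem absT_fin {A : Type*} [CommRing A] {k : ℕ} (f y : Fin k → A) (t : A)
    (h : ∀ a, f a = y a * (1 + ∑ c, (if a < c then 1 else if c < a then t else 0) * f c)) :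
    (∑ c, f c) * (∏ c, (1 + t * y c) - t * ∏ c, (1 + 1 * y c)) =
      ∏ c, (1 + 1 * y c) - ∏ c, (1 + t * y c) := by
  have := absT k (exN f) (exN y) t _ rfl (by
    intro a ha
    have h1 := h ⟨a, ha⟩
    rw [sum_step] at h1
    have e1 := exN_val f ⟨a, ha⟩
    have e2 := exN_val y ⟨a, ha⟩
    simp only at e1 e2 h1
    rw [e1, e2]
    linear_combination h1)
  rw [← prod_ex, ← prod_ex]
  simp only [one_mul]
  rw [← this, ← Fin.sum_univ_eq_sum_range]
  simp [exN_val]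

theorem absB_fin {A : Type*} [CommRing A] [IsDomain A] {k : ℕ} (f y : Fin k → A) (t : A)
    (b : Fin k) (hy : ∀ a, 1 + y a ≠ 0)
    (h : ∀ a, f a = y a * ((if a = b then 1 else 0) +
      ∑ c, (if a < c then 1 else if c < a then t else 0) * f c)) :
    f b * (∏ c, (1 + t * y c) - t * ∏ c, (1 + 1 * y c)) =
      y b * (∏ c ∈ univ.erase b, (1 + t * y c) - t * ∏ c ∈ univ.erase b, (1 + 1 * y c)) := by
  have := absB k b b.isLt (exN f) (exN y) t _ rfl (by
      intro a
      unfold exN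
      split_ifs
      · exact hy _
      · simp) (by
    intro a ha
    have h1 := h ⟨a, ha⟩
    rw [sum_step] at h1
    have e1 := exN_val f ⟨a, ha⟩
    have e2 := exN_val y ⟨a, ha⟩
    simp only [Fin.ext_iff] at e1 e2 h1
    rw [e1, e2]
    linear_combination h1)
  rw [← prod_ex, ← prod_ex, ← prod_ex_erase, ← prod_ex_erase]
  simp only [one_mul]
  rw [exN_val, exN_val] at this
  exact this

def Nst {k : ℕ} (a c : Fin k) : Polynomial (MvPolynomial (Fin k) ℤ) :=
  if a < c then 1 else if c < a then Polynomial.X else 0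

def wtw {n k : ℕ} (w : Fin n → Fin k) : Polynomial (MvPolynomial (Fin k) ℤ) :=
  if IsSmirnov w then Polynomial.X ^ desc w * Polynomial.C (xw ℤ w) else 0

theorem wtw_one {k : ℕ} (w : Fin 1 → Fin k) : wtw w = Polynomial.C (MvPolynomial.X (w 0)) := by
  have h1 : IsSmirnov w := by
    intro i h; omega
  have h2 : desc w = 0 := by
    unfold desc
    rw [Finset.card_eq_zero, Finset.filter_eq_empty_iff]
    rintro i - ⟨h, _⟩; omega
  simp [wtw, h1, h2, xw]

theorem smirnov_cons {n k : ℕ} (a : Fin k) (w : Fin (n+1) → Fin k) :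
    IsSmirnov (Fin.cons a w : Fin (n+2) → Fin k) ↔ w 0 ≠ a ∧ IsSmirnov w := by
  unfold IsSmirnov
  rw [Fin.forall_fin_succ]
  apply and_congr
  · constructor
    · intro h
      exact h (by simp)
    · intro h _
      exact h
  · apply forall_congr'
    intro i
    constructor
    · intro h hi
      exact h (by simpa using hi)
    · intro h hi
      exact h (by simpa using hi)

theorem desc_cons {n k : ℕ} (a : Fin k) (w : Fin (n+1) → Fin k) :
    desc (Fin.cons a w : Fin (n+2) → Fin k) = (if w 0 < a then 1 else 0) + desc w := by
  unfold desc
  rw [Finset.card_filter, Finset.card_filter, Fin.sum_univ_succ]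
  congr 1
  · have : (∃ h : ((0 : Fin (n+2)) : ℕ) + 1 < n + 2,
        (Fin.cons a w : Fin (n+2) → Fin k) ⟨((0 : Fin (n+2)) : ℕ) + 1, h⟩ <
        (Fin.cons a w : Fin (n+2) → Fin k) 0) ↔ w 0 < a := by
      constructor
      · rintro ⟨_, h⟩; exact h
      · intro h; exact ⟨by simp, h⟩
    simp only [this]
  · apply Finset.sum_congr rfl
    intro i _
    have : (∃ h : ((i.succ : Fin (n+2)) : ℕ) + 1 < n + 2,
        (Fin.cons a w : Fin (n+2) → Fin k) ⟨((i.succ : Fin (n+2)) : ℕ) + 1, h⟩ <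
        (Fin.cons a w : Fin (n+2) → Fin k) i.succ) ↔
        ∃ h : (i : ℕ) + 1 < n + 1, w ⟨(i : ℕ) + 1, h⟩ < w i := by
      constructor
      · rintro ⟨h0, h⟩; exact ⟨by simpa using h0, h⟩
      · rintro ⟨h0, h⟩; exact ⟨by simpa using h0, h⟩
    simp only [this]

theorem wtw_cons {n k : ℕ} (a : Fin k) (w : Fin (n+1) → Fin k) :
    wtw (Fin.cons a w : Fin (n+2) → Fin k) =
      Polynomial.C (MvPolynomial.X a) * Nst a (w 0) * wtw w := by
  have hx : xw ℤ (Fin.cons a w : Fin (n+2) → Fin k) = MvPolynomial.X a * xw ℤ w := by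
    unfold xw
    rw [Fin.prod_univ_succ]; simp
  unfold wtw Nst
  rw [smirnov_cons, desc_cons, hx]
  by_cases hs : IsSmirnov w
  · rcases lt_trichotomy a (w 0) with h | h | h
    · simp [hs, h, h.ne', h.not_gt]; ring
    · simp [hs, h]
    · simp [hs, h, h.ne, h.not_gt]; ring
  · simp [hs]

def Gw {k : ℕ} (n : ℕ) (a b : Fin k) : Polynomial (MvPolynomial (Fin k) ℤ) :=
  ∑ w : Fin (n+1) → Fin k, if w 0 = a ∧ w (Fin.last n) = b then wtw w else 0

theorem Gw_zero {k : ℕ} (a b : Fin k) :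
    Gw 0 a b = if a = b then Polynomial.C (MvPolynomial.X a) else 0 := by
  unfold Gw
  rw [← (Equiv.funUnique (Fin 1) (Fin k)).symm.sum_comp]
  simp only [wtw_one]
  simp only [Equiv.funUnique_symm_apply, uniqueElim_const]
  by_cases h : a = b
  · subst h
    simp
  · rw [if_neg h]
    apply Finset.sum_eq_zero
    intro x _
    rw [if_neg]
    rintro ⟨rfl, rfl⟩
    exact h rfl

theorem Gw_succ {k : ℕ} (n : ℕ) (a b : Fin k) :
    Gw (n+1) a b = Polynomial.C (MvPolynomial.X a) * ∑ c, Nst a c * Gw n c b := by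
  unfold Gw
  rw [← (Fin.consEquiv (fun _ : Fin (n+2) => Fin k)).sum_comp, Fintype.sum_prod_type]
  have h1 : ∀ (x : Fin k) (w : Fin (n+1) → Fin k),
      (Fin.consEquiv (fun _ : Fin (n+2) => Fin k)) (x, w) = (Fin.cons x w : Fin (n+2) → Fin k) :=
    fun _ _ => rfl
  simp only [h1, wtw_cons, Fin.cons_zero, ← Fin.succ_last, Fin.cons_succ]
  rw [Finset.sum_eq_single a]
  · simp only [Finset.mul_sum]
    rw [Finset.sum_comm]
    apply Finset.sum_congr rfl
    intro w _
    rw [Finset.sum_eq_single (w 0)]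
    · simp [mul_assoc]
    · intro c _ hc
      rw [if_neg (fun h => hc h.1.symm)]; simp
    · simp
  · intro x _ hx
    simp [hx]
  · simp

theorem enum_eq {k : ℕ} (n : ℕ) :
    smirnovEnum ℤ (n+1) k desc FirstNeLast =
      ∑ a : Fin k, ∑ b : Fin k, Gw n a b - ∑ b : Fin k, Gw n b b := by
  have h1 : ∀ w : Fin (n+1) → Fin k, FirstNeLast w ↔ w 0 ≠ w (Fin.last n) := by
    intro w
    constructor
    · rintro ⟨_, h⟩; exact h
    · intro h; exact ⟨by simp, h⟩
  have h2 : ∑ a : Fin k, ∑ b : Fin k, Gw n a b = ∑ w : Fin (n+1) → Fin k, wtw w := by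
    unfold Gw
    simp_rw [Finset.sum_comm (t := (univ : Finset (Fin (n+1) → Fin k)))]
    apply Finset.sum_congr rfl
    intro w _
    rw [Finset.sum_eq_single (w 0), Finset.sum_eq_single (w (Fin.last n))]
    · simp
    · intro b _ hb; rw [if_neg (fun h => hb h.2.symm)]
    · simp
    · intro b _ hb
      apply Finset.sum_eq_zero
      intro c _; rw [if_neg (fun h => hb h.1.symm)]
    · simp
  have h3 : ∑ b : Fin k, Gw n b b =
      ∑ w : Fin (n+1) → Fin k, if w 0 = w (Fin.last n) then wtw w else 0 := by
    unfold Gw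
    rw [Finset.sum_comm]
    apply Finset.sum_congr rfl
    intro w _
    rw [Finset.sum_eq_single (w 0)]
    · simp [eq_comm]
    · intro b _ hb; rw [if_neg (fun h => hb h.1.symm)]
    · simp
  rw [h2, h3, ← Finset.sum_sub_distrib]
  unfold smirnovEnum
  rw [Finset.sum_filter]
  apply Finset.sum_congr rfl
  intro w _
  rw [h1]
  unfold wtw
  by_cases hs : IsSmirnov w <;> by_cases he : w 0 = w (Fin.last n) <;> simp [hs, he]

theorem EPosT_of {k : ℕ} {ι : Type*} (J : Finset ι) (m : ι → Multiset ℕ) (c : ι → Polynomial ℤ)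
    (hm : ∀ j ∈ J, ∀ i ∈ m j, 0 < i) (hc : ∀ j ∈ J, ∀ d, 0 ≤ (c j).coeff d)
    (P : Polynomial (MvPolynomial (Fin k) ℤ))
    (hP : P = ∑ j ∈ J, ((c j).map (MvPolynomial.C : ℤ →+* MvPolynomial (Fin k) ℤ)) *
          Polynomial.C (((m j).map (esymm (Fin k) ℤ)).prod)) : EPosT ℤ P := by
  refine ⟨J.image m, fun μ => ∑ j ∈ J.filter (fun j => m j = μ), c j, ?_, ?_, ?_⟩
  · intro μ hμ
    obtain ⟨j, hj, rfl⟩ := Finset.mem_image.mp hμ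
    exact hm j hj
  · intro μ _ d
    rw [Polynomial.finsetSum_coeff]
    exact Finset.sum_nonneg fun j hj => hc j (Finset.mem_filter.mp hj).1 d
  · rw [hP, ← Finset.sum_fiberwise_of_maps_to (g := m) (t := J.image m)
      (fun j hj => Finset.mem_image_of_mem m hj)]
    apply Finset.sum_congr rfl
    intro μ _
    rw [Polynomial.map_sum, Finset.sum_mul]
    apply Finset.sum_congr rfl
    intro j hj
    rw [(Finset.mem_filter.mp hj).2]

theorem EPosT_zero {k : ℕ} : EPosT ℤ (0 : Polynomial (MvPolynomial (Fin k) ℤ)) :=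
  ⟨∅, 0, by simp, by simp, by simp⟩

theorem EPosT_add {k : ℕ} {P Q : Polynomial (MvPolynomial (Fin k) ℤ)}
    (hP : EPosT ℤ P) (hQ : EPosT ℤ Q) : EPosT ℤ (P + Q) := by
  obtain ⟨S, c, h1, h2, h3⟩ := hP
  obtain ⟨S', c', h1', h2', h3'⟩ := hQ
  apply EPosT_of (S.disjSum S') (Sum.elim id id) (Sum.elim c c')
  · rintro (j | j) hj
    · exact h1 j (by simpa using hj)
    · exact h1' j (by simpa using hj)
  · rintro (j | j) hj
    · exact h2 j (by simpa using hj)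
    · exact h2' j (by simpa using hj)
  · rw [Finset.sum_disjSum, h3, h3']; rfl

theorem EPosT_sum {k : ℕ} {ι : Type*} (J : Finset ι) (P : ι → Polynomial (MvPolynomial (Fin k) ℤ))
    (h : ∀ j ∈ J, EPosT ℤ (P j)) : EPosT ℤ (∑ j ∈ J, P j) := by
  induction J using Finset.cons_induction with
  | empty => simpa using EPosT_zero
  | cons a s ha ih =>
    rw [Finset.sum_cons]
    exact EPosT_add (h a (by simp)) (ih fun j hj => h j (by simp [hj]))

theorem coeff_mul_nonneg {p q : Polynomial ℤ} (hp : ∀ d, 0 ≤ p.coeff d) (hq : ∀ d, 0 ≤ q.coeff d) :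
    ∀ d, 0 ≤ (p * q).coeff d := by
  intro d
  rw [Polynomial.coeff_mul]
  exact Finset.sum_nonneg fun x _ => mul_nonneg (hp _) (hq _)

theorem EPosT_mul {k : ℕ} {P : Polynomial (MvPolynomial (Fin k) ℤ)} (hP : EPosT ℤ P)
    (p : Polynomial ℤ) (hp : ∀ d, 0 ≤ p.coeff d) (i : ℕ) (hi : 0 < i) :
    EPosT ℤ (p.map (MvPolynomial.C : ℤ →+* MvPolynomial (Fin k) ℤ) *
      Polynomial.C (esymm (Fin k) ℤ i) * P) := by
  obtain ⟨S, c, h1, h2, h3⟩ := hP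
  apply EPosT_of S (fun μ => i ::ₘ μ) (fun μ => p * c μ)
  · intro μ hμ j hj
    rcases Multiset.mem_cons.mp hj with rfl | hj
    · exact hi
    · exact h1 μ hμ j hj
  · intro μ hμ
    exact coeff_mul_nonneg hp (h2 μ hμ)
  · rw [h3, Finset.mul_sum]
    apply Finset.sum_congr rfl
    intro μ _
    simp only [Multiset.map_cons, Multiset.prod_cons, Polynomial.map_mul, Polynomial.C_mul]
    ring

theorem EPosT_one {k : ℕ} : EPosT ℤ (1 : Polynomial (MvPolynomial (Fin k) ℤ)) := by
  refine ⟨{0}, fun _ => 1, by simp, ?_, by simp⟩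
  intro _ _ j
  rw [Polynomial.coeff_one]; split_ifs <;> simp

theorem EPosT_symm {k : ℕ} {P : Polynomial (MvPolynomial (Fin k) ℤ)} (hP : EPosT ℤ P) :
    SymmX ℤ P := by
  obtain ⟨S, c, h1, h2, h3⟩ := hP
  intro j
  rw [h3, Polynomial.finsetSum_coeff]
  apply (MvPolynomial.symmetricSubalgebra (Fin k) ℤ).sum_mem
  intro μ _
  rw [Polynomial.coeff_mul_C, Polynomial.coeff_map]
  apply (MvPolynomial.symmetricSubalgebra (Fin k) ℤ).mul_mem
  · exact MvPolynomial.IsSymmetric.C _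
  · apply (MvPolynomial.symmetricSubalgebra (Fin k) ℤ).multiset_prod_mem
    intro x hx
    obtain ⟨i, _, rfl⟩ := Multiset.mem_map.mp hx
    exact MvPolynomial.esymm_isSymmetric _ _ _

def tz (m : ℕ) : Polynomial ℤ := ∑ j ∈ Finset.range m, Polynomial.X ^ j

theorem tz_map (k m : ℕ) :
    (tz m).map (MvPolynomial.C : ℤ →+* MvPolynomial (Fin k) ℤ) = tnum ℤ k m := by
  simp [tz, tnum, Polynomial.map_sum]

theorem tz_nonneg (m d : ℕ) : 0 ≤ (tz m).coeff d := by
  unfold tz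
  rw [Polynomial.finsetSum_coeff]
  apply Finset.sum_nonneg
  intro j _
  rw [Polynomial.coeff_X_pow]; split_ifs <;> simp

theorem coeff_E {K : Type*} [CommRing K] {k : ℕ} (c : Fin k → K) (i : ℕ) :
    (∏ a, (1 + Polynomial.C (c a) * Polynomial.X)).coeff i =
      ∑ u ∈ powersetCard i univ, ∏ a ∈ u, c a := by
  rw [Finset.prod_one_add, Polynomial.finsetSum_coeff, Finset.powersetCard_eq_filter,
    Finset.sum_filter]
  apply Finset.sum_congr rfl
  intro u _
  rw [Finset.prod_mul_distrib, Finset.prod_const, ← map_prod, Polynomial.coeff_C_mul_X_pow]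
  simp [eq_comm]

theorem coeff_E' {K : Type*} [CommRing K] {k : ℕ} (c : Fin k → K) (i : ℕ) :
    (∑ b, (Polynomial.C (c b) * Polynomial.X) *
      ∏ a ∈ univ.erase b, (1 + Polynomial.C (c a) * Polynomial.X)).coeff i =
      (i : K) * (∏ a, (1 + Polynomial.C (c a) * Polynomial.X)).coeff i := by
  have : (∑ b, (Polynomial.C (c b) * Polynomial.X) *
      ∏ a ∈ univ.erase b, (1 + Polynomial.C (c a) * Polynomial.X)) =
      Polynomial.X * Polynomial.derivative (∏ a, (1 + Polynomial.C (c a) * Polynomial.X)) := by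
    rw [Polynomial.derivative_prod_finset, Finset.mul_sum]
    apply Finset.sum_congr rfl
    intro b _
    simp
    ring
  rw [this]
  cases i with
  | zero => simp
  | succ i =>
    rw [Polynomial.coeff_X_mul, Polynomial.coeff_derivative]
    push_cast; ring

def ys {k : ℕ} (a : Fin k) : PowerSeries (Polynomial (MvPolynomial (Fin k) ℤ)) :=
  PowerSeries.C (Polynomial.C (MvPolynomial.X a)) * PowerSeries.X

theorem coeff_Es {k : ℕ} (s : Polynomial (MvPolynomial (Fin k) ℤ)) (i : ℕ) :
    PowerSeries.coeff i (∏ a : Fin k, (1 + PowerSeries.C s * ys a)) =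
      s ^ i * Polynomial.C (esymm (Fin k) ℤ i) := by
  have h : (∏ a : Fin k, (1 + PowerSeries.C s * ys a)) =
      Polynomial.coeToPowerSeries.ringHom (∏ a : Fin k,
        (1 + Polynomial.C (s * Polynomial.C (MvPolynomial.X a)) * Polynomial.X)) := by
    rw [map_prod]
    simp [ys, mul_assoc]
  rw [h, Polynomial.coeToPowerSeries.ringHom_apply, Polynomial.coeff_coe, coeff_E, esymm, map_sum,
    Finset.mul_sum]
  apply Finset.sum_congr rfl
  intro u hu
  rw [Finset.prod_mul_distrib, Finset.prod_const, (Finset.mem_powersetCard.mp hu).2, map_prod]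

theorem coeff_Es' {k : ℕ} (s : Polynomial (MvPolynomial (Fin k) ℤ)) (i : ℕ) :
    PowerSeries.coeff i (∑ b : Fin k, (PowerSeries.C s * ys b) *
      ∏ a ∈ univ.erase b, (1 + PowerSeries.C s * ys a)) =
      i * (s ^ i * Polynomial.C (esymm (Fin k) ℤ i)) := by
  have h : (∑ b : Fin k, (PowerSeries.C s * ys b) *
      ∏ a ∈ univ.erase b, (1 + PowerSeries.C s * ys a)) =
      Polynomial.coeToPowerSeries.ringHom (∑ b : Fin k,
        (Polynomial.C (s * Polynomial.C (MvPolynomial.X b)) * Polynomial.X) *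
        ∏ a ∈ univ.erase b,
        (1 + Polynomial.C (s * Polynomial.C (MvPolynomial.X a)) * Polynomial.X)) := by
    rw [map_sum]
    simp only [map_mul, map_prod]
    simp [ys, mul_assoc]
  have h2 : (∏ a : Fin k, (1 + PowerSeries.C s * ys a)) =
      Polynomial.coeToPowerSeries.ringHom (∏ a : Fin k,
        (1 + Polynomial.C (s * Polynomial.C (MvPolynomial.X a)) * Polynomial.X)) := by
    rw [map_prod]
    simp [ys, mul_assoc]
  rw [← coeff_Es, h, h2, Polynomial.coeToPowerSeries.ringHom_apply,
    Polynomial.coeToPowerSeries.ringHom_apply, Polynomial.coeff_coe, Polynomial.coeff_coe, coeff_E']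

theorem tnum_geom (k m : ℕ) : (1 - Polynomial.X) * tnum ℤ k m = 1 - Polynomial.X ^ m :=
  mul_neg_geom_sum _ _

theorem Dser_eq (k : ℕ) : (1 - PowerSeries.C Polynomial.X) * Dser ℤ k =
    ∏ a : Fin k, (1 + PowerSeries.C Polynomial.X * ys a) -
      PowerSeries.C Polynomial.X * ∏ a : Fin k, (1 + 1 * ys a) := by
  have h1 : ∏ a : Fin k, (1 + 1 * ys a) = ∏ a : Fin k, (1 + PowerSeries.C 1 * ys a) := by simp
  rw [h1]
  have h2 : (1 - PowerSeries.C Polynomial.X :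
      PowerSeries (Polynomial (MvPolynomial (Fin k) ℤ))) = PowerSeries.C (1 - Polynomial.X) := by
    simp
  rw [h2]
  ext1 i
  rw [PowerSeries.coeff_C_mul, map_sub, PowerSeries.coeff_C_mul, coeff_Es, coeff_Es, Dser,
    PowerSeries.coeff_mk]
  rcases i with _ | _ | i
  · simp
  · simp
  · have := tnum_geom k (i + 1)
    simp only [show i + 1 + 1 ≠ 0 by omega, show i + 1 + 1 ≠ 1 by omega, if_false,
      show i + 1 + 1 - 1 = i + 1 by omega, one_pow]
    linear_combination (-Polynomial.X * Polynomial.C (esymm (Fin k) ℤ (i + 1 + 1))) * this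

def Fs {k : ℕ} (a b : Fin k) : PowerSeries (Polynomial (MvPolynomial (Fin k) ℤ)) :=
  PowerSeries.X * PowerSeries.mk (fun n => Gw n a b)

theorem Nst_C {k : ℕ} (a c : Fin k) : PowerSeries.C (Nst a c) =
    (if a < c then 1 else if c < a then PowerSeries.C Polynomial.X else 0) := by
  unfold Nst; split_ifs <;> simp

theorem Fs_eq {k : ℕ} (a b : Fin k) :
    Fs a b = ys a * ((if a = b then 1 else 0) + ∑ c,
      (if a < c then 1 else if c < a then PowerSeries.C Polynomial.X else 0) * Fs c b) := by
  simp only [← Nst_C]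
  have h : ∑ c, PowerSeries.C (Nst a c) * Fs c b =
      PowerSeries.X * PowerSeries.mk (fun n => ∑ c, Nst a c * Gw n c b) := by
    have : (PowerSeries.mk (fun n => ∑ c, Nst a c * Gw n c b)) =
        ∑ c, PowerSeries.C (Nst a c) * PowerSeries.mk (fun n => Gw n c b) := by
      ext1 n
      simp [map_sum, PowerSeries.coeff_C_mul]
    rw [this, Finset.mul_sum]
    apply Finset.sum_congr rfl
    intro c _
    unfold Fs; ring
  rw [h]
  unfold Fs ys
  have : PowerSeries.mk (fun n => Gw n a b) = PowerSeries.C (Polynomial.C (MvPolynomial.X a)) *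
      ((if a = b then 1 else 0) +
        PowerSeries.X * PowerSeries.mk (fun n => ∑ c, Nst a c * Gw n c b)) := by
    ext1 n
    rw [PowerSeries.coeff_C_mul, PowerSeries.coeff_mk, map_add]
    cases n with
    | zero => rw [Gw_zero]; split_ifs <;> simp
    | succ n =>
      rw [Gw_succ, PowerSeries.coeff_succ_X_mul, PowerSeries.coeff_mk]
      split_ifs <;> simp [PowerSeries.coeff_one]
  rw [this]; ring

theorem ys_ne {k : ℕ} (a : Fin k) : 1 + ys a ≠ 0 := by
  intro h
  have := congrArg (PowerSeries.coeff 0) h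
  simp [ys] at this

theorem W_eq (k : ℕ) :
    PowerSeries.mk (fun n => if n = 0 then 0 else smirnovEnum ℤ n k desc FirstNeLast) =
      ∑ a : Fin k, ∑ b : Fin k, Fs a b - ∑ b : Fin k, Fs b b := by
  ext1 n
  rw [PowerSeries.coeff_mk, map_sub, map_sum, map_sum]
  simp only [map_sum, Fs]
  cases n with
  | zero => simp
  | succ n => simp [PowerSeries.coeff_succ_X_mul, enum_eq]

theorem main_id (k : ℕ) : Dser ℤ k *
      PowerSeries.mk (fun n => if n = 0 then 0 else smirnovEnum ℤ n k desc FirstNeLast) =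
    PowerSeries.mk (fun i =>
      if 2 ≤ i then
        (tnum ℤ k i + (i : Polynomial (MvPolynomial (Fin k) ℤ)) * Polynomial.X *
            tnum ℤ k (i - 2)) * Polynomial.C (esymm (Fin k) ℤ i)
      else 0) := by
  rw [W_eq]
  set t : PowerSeries (Polynomial (MvPolynomial (Fin k) ℤ)) := PowerSeries.C Polynomial.X with ht
  have hT := absT_fin (fun a : Fin k => ∑ b, Fs a b) ys t (by
    intro a
    simp only [Finset.mul_sum]
    rw [Finset.sum_comm, mul_add, Finset.mul_sum, mul_one]
    conv_lhs => arg 2; ext b; rw [Fs_eq a b, mul_add]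
    rw [Finset.sum_add_distrib]
    congr 1
    simp)
  have hB : ∀ b : Fin k, _ := fun b =>
    absB_fin (fun a : Fin k => Fs a b) ys t b ys_ne (fun a => Fs_eq a b)
  have hD := Dser_eq k
  have hBs : (∑ b : Fin k, Fs b b) * (t * ((1 - t) * Dser ℤ k)) =
      (∑ b : Fin k, (t * ys b) * ∏ a ∈ univ.erase b, (1 + t * ys a)) -
      t ^ 2 * (∑ b : Fin k, (1 * ys b) * ∏ a ∈ univ.erase b, (1 + 1 * ys a)) := by
    rw [Finset.sum_mul, Finset.mul_sum, ← Finset.sum_sub_distrib]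
    apply Finset.sum_congr rfl
    intro b _
    have := hB b
    rw [hD]
    linear_combination t * this
  have hne : PowerSeries.C (Polynomial.X * (1 - Polynomial.X) :
      Polynomial (MvPolynomial (Fin k) ℤ)) ≠ 0 := by
    intro h
    have h1 := congrArg (PowerSeries.coeff 0) h
    have h2 := congrArg (fun p => Polynomial.coeff p 1) h1
    simp at h2
  apply mul_left_cancel₀ hne
  have hC : PowerSeries.C (Polynomial.X * (1 - Polynomial.X) :
      Polynomial (MvPolynomial (Fin k) ℤ)) = t * (1 - t) := by simp [ht]
  have hmain : PowerSeries.C (Polynomial.X * (1 - Polynomial.X)) *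
      (Dser ℤ k * (∑ a : Fin k, ∑ b : Fin k, Fs a b - ∑ b : Fin k, Fs b b)) =
      t * (∏ c : Fin k, (1 + PowerSeries.C 1 * ys c) - ∏ c : Fin k, (1 + t * ys c)) -
      (∑ b : Fin k, (t * ys b) * ∏ a ∈ univ.erase b, (1 + t * ys a)) +
      PowerSeries.C (Polynomial.X ^ 2) *
       (∑ b : Fin k, (PowerSeries.C 1 * ys b) * ∏ a ∈ univ.erase b,
        (1 + PowerSeries.C 1 * ys a)) := by
    rw [hC, map_pow, ← ht, map_one]
    rw [← hD] at hT
    linear_combination t * hT - hBs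
  rw [hmain]
  ext1 i
  rw [map_add, map_sub, ht, PowerSeries.coeff_C_mul, PowerSeries.coeff_C_mul, map_sub, coeff_Es,
    coeff_Es, coeff_Es', coeff_Es', PowerSeries.coeff_C_mul, PowerSeries.coeff_mk]
  rcases i with _ | _ | i
  · simp
  · simp; ring
  · have h1 := tnum_geom k (i + 1 + 1)
    have h2 := tnum_geom k i
    rw [if_pos (by omega), show i + 1 + 1 - 2 = i by omega]
    simp only [one_pow]
    linear_combination (-Polynomial.X * Polynomial.C (esymm (Fin k) ℤ (i + 1 + 1))) * h1
      - ((i + 1 + 1 : ℕ) : Polynomial (MvPolynomial (Fin k) ℤ)) * Polynomial.X ^ 2 *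
        Polynomial.C (esymm (Fin k) ℤ (i + 1 + 1)) * h2

theorem epos_all (k n : ℕ) :
    EPosT ℤ (if n = 0 then 0 else smirnovEnum ℤ n k desc FirstNeLast) := by
  induction n using Nat.strong_induction_on with
  | _ n ih =>
  have h := congrArg (PowerSeries.coeff n) (main_id k)
  rw [PowerSeries.coeff_mul, Finset.Nat.sum_antidiagonal_eq_sum_range_succ_mk,
    Finset.sum_range_succ', PowerSeries.coeff_mk] at h
  simp only [PowerSeries.coeff_mk, Nat.sub_zero] at h
  have h0 : PowerSeries.coeff 0 (Dser ℤ k) = 1 := by simp [Dser]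
  rw [h0, one_mul] at h
  rw [eq_sub_of_add_eq' h, sub_eq_add_neg, ← Finset.sum_neg_distrib]
  apply EPosT_add
  · split_ifs with h2
    · have := EPosT_mul (k := k) EPosT_one (tz n + (n : Polynomial ℤ) * Polynomial.X * tz (n - 2))
        (by
          intro d
          rw [Polynomial.coeff_add]
          apply add_nonneg (tz_nonneg _ _)
          apply coeff_mul_nonneg _ (tz_nonneg _)
          apply coeff_mul_nonneg
          · intro d
            rw [Polynomial.coeff_natCast_ite]; split_ifs <;> simp
          · intro d
            rw [Polynomial.coeff_X]; split_ifs <;> simp) n (by omega)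
      simpa [tz_map] using this
    · exact EPosT_zero
  · apply EPosT_sum
    intro j hj
    have hj' := Finset.mem_range.mp hj
    rw [Dser, PowerSeries.coeff_mk, if_neg (by omega)]
    split_ifs with h1 h2 h2
    · simpa using EPosT_zero
    · simpa using EPosT_zero
    · simpa using EPosT_zero
    · have h3 := ih (n - (j + 1)) (by omega)
      rw [if_neg h2] at h3
      have := EPosT_mul h3 (Polynomial.X * tz (j + 1 - 1)) (by
        apply coeff_mul_nonneg _ (tz_nonneg _)
        intro d
        rw [Polynomial.coeff_X]; split_ifs <;> simp) (j + 1) (by omega)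
      rw [Polynomial.map_mul, tz_map, Polynomial.map_X] at this
      convert this using 1
      ring

/-- `D(x,t,z) · Σ_{n≥1} W_n^≠(x,t) z^n = Σ_{i≥2} ([i]_t + i·t[i-2]_t) e_i(x) z^i`;
consequently each `W_n^≠(x,t)` is symmetric in `x₁,…,x_k` and e-positive. -/
theorem smirnov_ne_enumerator (k : ℕ) (hk : 1 ≤ k) :
    (Dser ℤ k *
      PowerSeries.mk (fun n => if n = 0 then 0 else smirnovEnum ℤ n k desc FirstNeLast) =
    PowerSeries.mk (fun i =>
      if 2 ≤ i then
        (tnum ℤ k i + (i : Polynomial (MvPolynomial (Fin k) ℤ)) * Polynomial.X *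
            tnum ℤ k (i - 2)) * Polynomial.C (esymm (Fin k) ℤ i)
      else 0)) ∧
    ∀ n : ℕ, 1 ≤ n →
      SymmX ℤ (smirnovEnum ℤ n k desc FirstNeLast) ∧
      EPosT ℤ (smirnovEnum ℤ n k desc FirstNeLast) := by
  refine ⟨main_id k, fun n hn => ?_⟩
  have h := epos_all k n
  rw [if_neg (by omega)] at h
  exact ⟨EPosT_symm h, h⟩

end
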